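/- For every binary path P with P ≠ u^{|P|}, the degree of P is given by δ(P) = |P| − 1 − lv(P), where lv(P) is the height of the lowest valley of P. -/

import Mathlib

/-- A binary path is a list of steps: `true` = upstep `u`, `false` = downstep `d`. -/
abbrev BinPath := List Bool

/-- `ht P k` is the height of the `k`-th point of the path `P` (the point reached
after the first `k` steps). -/
def ht (P : BinPath) (k : ℕ) : ℤ :=
  ((P.take k).map (fun b => if b then (1 : ℤ) else -1)).sum

/-- The lattice order on binary paths of the same length: `P ≤ Q` iff
`hᵢ(P) ≤ hᵢ(Q)` for all `i`. -/
def pathLe (P Q : BinPath) : Prop :=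
  P.length = Q.length ∧ ∀ k, ht P k ≤ ht Q k

def pathLt (P Q : BinPath) : Prop := pathLe P Q ∧ P ≠ Q

/-- The maximum path `1ₙ = uⁿ`. -/
def maxPath (n : ℕ) : BinPath := List.replicate n true

/-- Step `i` (0-based) of `P` is a downstep whose endpoint is a valley, i.e. it is
followed by an upstep or it is the last step of `P`. -/
def isValley (P : BinPath) (i : ℕ) : Prop :=
  i < P.length ∧ P.getD i true = false ∧ P.getD (i + 1) true = true

/-- The number of valleys of `P`. -/
def numValleys (P : BinPath) : ℕ :=
  ((Finset.range P.length).filter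
    (fun i => P.getD i true = false ∧ P.getD (i + 1) true = true)).card

/-- The filling of `P`: every valley of `P` is turned into a peak
(each occurrence `du` whose middle point is a valley becomes `ud`, and a final
valley-`d` becomes `u`). -/
def fill (P : BinPath) : BinPath :=
  List.ofFn (fun i : Fin P.length =>
    if P.get i then P.getD (i.1 - 1) true else P.getD (i.1 + 1) true)

/-- The degree of `P`: the least `k` such that the `k`-fold iterated filling
of `P` is the maximum path. -/
noncomputable def degree (P : BinPath) : ℕ :=
  sInf {k | fill^[k] P = maxPath P.length}

/-- `fPath P` is the number of chains from `P` to the maximum path `1_{|P|}` of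
length `degree P` having small intervals. -/
noncomputable def fPath (P : BinPath) : ℕ :=
  Set.ncard {c : ℕ → BinPath |
    c 0 = P ∧ (∀ i, degree P ≤ i → c i = maxPath P.length) ∧
    ∀ i < degree P, pathLt (c i) (c (i + 1)) ∧ pathLe (c (i + 1)) (fill (c i))}

/-- Height of the lowest valley of `P`. -/
noncomputable def lv (P : BinPath) : ℤ :=
  sInf {h : ℤ | ∃ i, isValley P i ∧ ht P (i + 1) = h}

/-- Height of the highest valley of `P`. -/
noncomputable def hv (P : BinPath) : ℤ :=
  sSup {h : ℤ | ∃ i, isValley P i ∧ ht P (i + 1) = h}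

noncomputable def hvNat (P : BinPath) : ℕ := (hv P).toNat

/-- `P′`: every low valley of `P` is turned into a peak. -/
noncomputable def lowFill (P : BinPath) : BinPath :=
  List.ofFn (fun i : Fin P.length =>
    if P.get i then
      (if P.getD (i.1 - 1) true = false ∧ ht P i.1 = lv P then false else true)
    else
      (if P.getD (i.1 + 1) true = true ∧ ht P (i.1 + 1) = lv P then true else false))

/-- `P*`: every valley of `P` is turned into a peak, except the last one when `P`
ends with a downstep. -/
def starFill (P : BinPath) : BinPath :=
  List.ofFn (fun i : Fin P.length =>
    if i.1 + 1 = P.length ∧ P.get i = false then false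
    else if P.get i then P.getD (i.1 - 1) true else P.getD (i.1 + 1) true)

/-- A Dyck path: starts and ends at height 0 and lies weakly above height 0. -/
def IsDyck (P : BinPath) : Prop := ht P P.length = 0 ∧ ∀ k, 0 ≤ ht P k

/-- A Dyck prefix: a prefix of a Dyck path. -/
def IsDyckPrefix (P : BinPath) : Prop := ∃ Q : BinPath, IsDyck (P ++ Q)

/-- A Dyck suffix: a suffix of a Dyck path. -/
def IsDyckSuffix (P : BinPath) : Prop := ∃ Q : BinPath, IsDyck (Q ++ P)

/-- The pyramid `u^m d^m`. -/
def pyramid (m : ℕ) : BinPath := List.replicate m true ++ List.replicate m false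

/-- Cardinality of the interval `[P, Q]` in the lattice of binary paths. -/
noncomputable def intervalCard (P Q : BinPath) : ℕ :=
  Set.ncard {R : BinPath | pathLe P R ∧ pathLe R Q}

/-- `I(s) = |[s, u^{|s|/2} d^{|s|/2}]|`. -/
noncomputable def Ifun (s : BinPath) : ℕ := intervalCard s (pyramid (s.length / 2))

/-- `J(P) = |[P, u^{|P|}]|`. -/
noncomputable def Jfun (P : BinPath) : ℕ := intervalCard P (maxPath P.length)

/-- `P` and `Q` have exactly the same valleys at every height at most `m`. -/
def sameValleysUpTo (P Q : BinPath) (m : ℤ) : Prop :=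
  ∀ (i : ℕ) (t : ℤ), t ≤ m →
    ((isValley P i ∧ ht P (i + 1) = t) ↔ (isValley Q i ∧ ht Q (i + 1) = t))

/-- A multichain of Dyck paths of type `V` from `a` to `s`: it has length
`h = hv(a)` and for every `j ∈ [h]` its `(j-1)`-st and `j`-th members have the
same valleys at every height at most `h - j`.  (The function `σ` is frozen from
index `h` on, so that such multichains are counted correctly.) -/
def IsVChain (a s : BinPath) (σ : ℕ → BinPath) : Prop :=
  σ 0 = a ∧ (∀ j, hvNat a ≤ j → σ j = s) ∧ (∀ j, IsDyck (σ j)) ∧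
  (∀ j < hvNat a, pathLe (σ j) (σ (j + 1))) ∧
  (∀ j, 1 ≤ j → j ≤ hvNat a →
    sameValleysUpTo (σ (j - 1)) (σ j) ((hvNat a : ℤ) - (j : ℤ)))

/-- `V(a,s)`: the number of `a`–`s` multichains of type `V`. -/
noncomputable def VPath (a s : BinPath) : ℕ :=
  Set.ncard {σ : ℕ → BinPath | IsVChain a s σ}

/-- `ζ^k(P,Q)`: the number of `P`–`Q` multichains of length `k`. -/
noncomputable def zetaPow (k : ℕ) (P Q : BinPath) : ℕ :=
  Set.ncard {c : ℕ → BinPath |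
    c 0 = P ∧ (∀ i, k ≤ i → c i = Q) ∧ ∀ i < k, pathLe (c i) (c (i + 1))}

/-- The join of two paths of the same length (pointwise max of heights). -/
def pathSup (P Q : BinPath) : BinPath :=
  List.ofFn (fun i : Fin P.length =>
    decide (max (ht P i.1) (ht Q i.1) < max (ht P (i.1 + 1)) (ht Q (i.1 + 1))))

/-- The meet of two paths of the same length (pointwise min of heights). -/
def pathInf (P Q : BinPath) : BinPath :=
  List.ofFn (fun i : Fin P.length =>
    decide (min (ht P i.1) (ht Q i.1) < min (ht P (i.1 + 1)) (ht Q (i.1 + 1))))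

/-- `Q` covers `P` in the lattice of binary paths. -/
def pathCovBy (P Q : BinPath) : Prop :=
  pathLt P Q ∧ ∀ R : BinPath, pathLt P R → pathLt R Q → False

/-- `l(P,Q) = (1/2)·Σᵢ (hᵢ(Q) − hᵢ(P))`. -/
def lpq (P Q : BinPath) : ℕ :=
  ((∑ i ∈ Finset.range P.length, (ht Q (i + 1) - ht P (i + 1))) / 2).toNat

/-- Convolution in the incidence algebra of the lattice of binary paths. -/
noncomputable def conv (F G : BinPath → BinPath → ℤ) : BinPath → BinPath → ℤ :=
  fun P Q => ∑ᶠ (R : BinPath) (_ : pathLe P R ∧ pathLe R Q), F P R * G R Q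

/-- The delta function of the incidence algebra. -/
def deltaFun : BinPath → BinPath → ℤ := fun P Q => if P = Q then 1 else 0

/-- `μ^k`: the `k`-th convolution power of `μ` (`μ^0` is the delta function). -/
noncomputable def muPow (mu : BinPath → BinPath → ℤ) (k : ℕ) : BinPath → BinPath → ℤ :=
  (conv mu)^[k] deltaFun

/-- Every downstep of `P` ends at height at least `c`. -/
def DownstepsAbove (P : BinPath) (c : ℤ) : Prop :=
  ∀ i, P.getD i true = false → c ≤ ht P (i + 1)

/-- Some downstep of `P` ends at height at most `c`. -/
def HasDownstepBelow (P : BinPath) (c : ℤ) : Prop :=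
  ∃ i, P.getD i true = false ∧ ht P (i + 1) ≤ c

theorem lt_length_of_getD_false {P : BinPath} {i : ℕ} (hi : P.getD i true = false) :
    i < P.length := by
  by_contra hn
  rw [List.getD_eq_default _ _ (not_lt.mp hn)] at hi
  exact Bool.noConfusion hi

theorem ht_zero (P : BinPath) : ht P 0 = 0 := by simp [ht]

theorem ht_succ {P : BinPath} {k : ℕ} (hk : k < P.length) :
    ht P (k + 1) = ht P k + if P.getD k true then 1 else -1 := by
  rw [ht, ht, List.take_add_one, List.getD_eq_getElem _ _ hk, List.getElem?_eq_getElem hk,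
    List.map_append, List.sum_append]
  simp only [Option.toList_some, List.map_cons, List.map_nil, List.sum_singleton]

theorem ht_succ_of_down {P : BinPath} {k : ℕ} (hk : P.getD k true = false) :
    ht P (k + 1) = ht P k - 1 := by
  rw [ht_succ (lt_length_of_getD_false hk), hk]
  simp [sub_eq_add_neg]

theorem ht_succ_of_up {P : BinPath} {k : ℕ} (hk : k < P.length) (hu : P.getD k true = true) :
    ht P (k + 1) = ht P k + 1 := by
  rw [ht_succ hk, hu]
  simp

theorem neg_le_ht_and_ht_le {P : BinPath} {k : ℕ} (hk : k ≤ P.length) :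
    -(k : ℤ) ≤ ht P k ∧ ht P k ≤ k := by
  induction k with
  | zero => simp [ht_zero]
  | succ k ih =>
    have := ih (by omega)
    rw [ht_succ (by omega)]
    push_cast
    split_ifs <;> omega

theorem length_fill (P : BinPath) : (fill P).length = P.length := by simp [fill]

theorem getD_fill {P : BinPath} {i : ℕ} (hi : i < P.length) :
    (fill P).getD i true =
      if P.getD i true then P.getD (i - 1) true else P.getD (i + 1) true := by
  simp [fill, hi]

/-- Filling raises exactly the valleys, each by two. -/
theorem ht_fill_succ {P : BinPath} {k : ℕ} (hk : k < P.length) :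
    ht (fill P) (k + 1) =
      ht P (k + 1) + if P.getD k true = false ∧ P.getD (k + 1) true = true then 2 else 0 := by
  induction k with
  | zero =>
    rw [ht_succ (by rwa [length_fill]), ht_succ hk, getD_fill hk, ht_zero, ht_zero]
    cases h0 : P.getD 0 true <;> cases h1 : P.getD 1 true <;> simp_all
  | succ k ih =>
    rw [ht_succ (by rwa [length_fill]), ht_succ hk, getD_fill hk, ih (by omega),
      Nat.add_sub_cancel]
    cases h0 : P.getD k true <;> cases h1 : P.getD (k + 1) true <;>
      cases h2 : P.getD (k + 1 + 1) true <;> simp <;> ring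

theorem eq_maxPath_iff {P : BinPath} :
    P = maxPath P.length ↔ ∀ i, P.getD i true = true := by
  constructor
  · intro h i
    rw [h]
    by_cases hi : i < P.length <;> simp [maxPath, List.getD_eq_getElem?_getD, hi]
  · intro h
    refine List.eq_replicate_of_mem fun b hb => ?_
    obtain ⟨i, hi, rfl⟩ := List.mem_iff_getElem.mp hb
    simpa [hi] using h i

/-- Following a downstep down to the next valley. -/
theorem exists_isValley_le {P : BinPath} {i : ℕ} (hi : P.getD i true = false) :
    ∃ j, isValley P j ∧ ht P (j + 1) ≤ ht P (i + 1) := by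
  induction hm : P.length - i generalizing i with
  | zero => have := lt_length_of_getD_false hi; omega
  | succ m ih =>
    have hlt := lt_length_of_getD_false hi
    cases hs : P.getD (i + 1) true with
    | true => exact ⟨i, ⟨hlt, hi, hs⟩, le_rfl⟩
    | false =>
      obtain ⟨j, hj, hle⟩ := ih hs (by omega)
      exact ⟨j, hj, hle.trans (by rw [ht_succ_of_down hs]; omega)⟩

/-- A point that is not reached by upsteps only is preceded by a downstep whose endpoint is
no higher. -/
theorem hasDownstepBelow_of_ht_lt {P : BinPath} {k : ℕ} (hk : k ≤ P.length)
    (hlt : ht P k < k) : HasDownstepBelow P (ht P k) := by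
  induction k with
  | zero => simp [ht_zero] at hlt
  | succ k ih =>
    cases hs : P.getD k true with
    | false => exact ⟨k, hs, le_rfl⟩
    | true =>
      have hu := ht_succ_of_up (by omega) hs
      obtain ⟨i, hi, hle⟩ := ih (by omega) (by push_cast at hlt; omega)
      exact ⟨i, hi, by omega⟩

theorem HasDownstepBelow.mono {P : BinPath} {c d : ℤ} (h : HasDownstepBelow P c) (hcd : c ≤ d) :
    HasDownstepBelow P d :=
  let ⟨i, hi, hle⟩ := h
  ⟨i, hi, hle.trans hcd⟩

theorem DownstepsAbove.succ_fill {P : BinPath} {c : ℤ} (h : DownstepsAbove P c) :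
    DownstepsAbove (fill P) (c + 1) := by
  intro i hi
  have hlt := lt_length_of_getD_false hi
  rw [length_fill] at hlt
  rw [getD_fill hlt] at hi
  have hge : ht P (i + 1) ≤ ht (fill P) (i + 1) := by
    rw [ht_fill_succ hlt]; split_ifs <;> omega
  refine le_trans ?_ hge
  cases hs : P.getD i true with
  | false =>
    simp only [hs, Bool.false_eq_true, if_false] at hi
    have := h _ hi
    rw [ht_succ_of_down hi] at this
    omega
  | true =>
    simp only [hs, if_true] at hi
    obtain _ | i := i
    · simp_all
    · have := h _ hi
      rw [ht_succ_of_up hlt hs]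
      simp only [Nat.add_sub_cancel] at this
      omega

theorem HasDownstepBelow.succ_fill {P : BinPath} {c : ℤ} (h : HasDownstepBelow P c)
    (hc : c + 3 ≤ P.length) : HasDownstepBelow (fill P) (c + 1) := by
  obtain ⟨i, hi, hle⟩ := h
  obtain ⟨j, ⟨hj, hd, hu⟩, hle'⟩ := exists_isValley_le hi
  have hb := (neg_le_ht_and_ht_le hj.le).2
  have hjd := ht_succ_of_down hd
  rcases Nat.lt_or_ge (j + 1) P.length with hlt | hge
  · refine HasDownstepBelow.mono (c := ht (fill P) (j + 2))
      (hasDownstepBelow_of_ht_lt (by rw [length_fill]; omega) ?_) ?_ <;>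
    · rw [ht_fill_succ hlt, ht_succ_of_up hlt hu]
      simp only [hu, Bool.true_eq_false, false_and, if_false]
      push_cast
      omega
  · have hf : ht (fill P) (j + 1) = ht P (j + 1) + 2 := by
      rw [ht_fill_succ hj, if_pos ⟨hd, hu⟩]
    have hs : (fill P).getD j true = true := by
      rw [getD_fill hj, hd]; simpa using hu
    have hup := ht_succ_of_up (by rwa [length_fill]) hs
    exact (hasDownstepBelow_of_ht_lt (k := j) (by rw [length_fill]; omega)
      (by omega)).mono (by omega)

theorem length_iterate_fill (P : BinPath) (t : ℕ) : (fill^[t] P).length = P.length := by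
  induction t with
  | zero => rfl
  | succ t ih => rw [Function.iterate_succ_apply', length_fill, ih]

theorem DownstepsAbove.iterate_fill {P : BinPath} {c : ℤ} (h : DownstepsAbove P c) (t : ℕ) :
    DownstepsAbove (fill^[t] P) (c + t) := by
  induction t with
  | zero => simpa using h
  | succ t ih =>
    rw [Function.iterate_succ_apply']
    simpa [add_assoc] using ih.succ_fill

theorem HasDownstepBelow.iterate_fill {P : BinPath} {c : ℤ} (h : HasDownstepBelow P c) {t : ℕ}
    (hc : c + t + 2 ≤ P.length) : HasDownstepBelow (fill^[t] P) (c + t) := by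
  induction t with
  | zero => simpa using h
  | succ t ih =>
    rw [Function.iterate_succ_apply']
    push_cast at hc ⊢
    rw [← add_assoc]
    exact (ih (by omega)).succ_fill (by rw [length_iterate_fill]; omega)

theorem ht_add_two_le_length_of_down {P : BinPath} {i : ℕ} (hi : P.getD i true = false) :
    ht P (i + 1) + 2 ≤ P.length := by
  have hlt := lt_length_of_getD_false hi
  have := (neg_le_ht_and_ht_le hlt.le).2
  rw [ht_succ_of_down hi]
  omega

theorem downstepsAbove_lv (P : BinPath) : DownstepsAbove P (lv P) := by
  intro i hi
  obtain ⟨j, hj, hle⟩ := exists_isValley_le hi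
  refine le_trans (csInf_le ⟨-(P.length : ℤ), ?_⟩ ⟨j, hj, rfl⟩) hle
  rintro _ ⟨k, hk, rfl⟩
  have hlt := hk.1
  have := (neg_le_ht_and_ht_le (Nat.succ_le_of_lt hlt)).1
  push_cast at this
  simp only [Nat.succ_eq_add_one] at this
  omega

theorem exists_down_ht_eq_lv {P : BinPath} (h : P ≠ maxPath P.length) :
    ∃ i, P.getD i true = false ∧ ht P (i + 1) = lv P := by
  rw [Ne, eq_maxPath_iff, not_forall] at h
  obtain ⟨i, hi⟩ := h
  obtain ⟨j, hj, -⟩ := exists_isValley_le (Bool.eq_false_of_not_eq_true hi)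
  have hne : {x : ℤ | ∃ i, isValley P i ∧ ht P (i + 1) = x}.Nonempty := ⟨_, j, hj, rfl⟩
  have hbdd : BddBelow {x : ℤ | ∃ i, isValley P i ∧ ht P (i + 1) = x} := by
    refine ⟨lv P, ?_⟩
    rintro _ ⟨k, hk, rfl⟩
    exact downstepsAbove_lv P k hk.2.1
  obtain ⟨k, hk, hkl⟩ := Int.csInf_mem hne hbdd
  exact ⟨k, hk.2.1, hkl⟩

/-- For every binary path `P ≠ u^{|P|}`,
`δ(P) = |P| − 1 − lv(P)`. -/
theorem statement6 (P : BinPath) (h : P ≠ maxPath P.length) :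
    (degree P : ℤ) = (P.length : ℤ) - 1 - lv P := by
  obtain ⟨i, hi, hlv⟩ := exists_down_ht_eq_lv h
  have hle := ht_add_two_le_length_of_down hi
  obtain ⟨t, htl⟩ : ∃ t : ℕ, (t : ℤ) = P.length - 1 - lv P :=
    ⟨((P.length : ℤ) - 1 - lv P).toNat, Int.toNat_of_nonneg (by omega)⟩
  suffices IsLeast {k | fill^[k] P = maxPath P.length} t by
    rw [degree, this.csInf_eq, htl]
  constructor
  · change fill^[t] P = maxPath P.length
    rw [← length_iterate_fill P t, eq_maxPath_iff]
    intro j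
    by_contra hj
    have hjd := Bool.eq_false_of_not_eq_true hj
    have hlow := (downstepsAbove_lv P).iterate_fill t j hjd
    have hhigh := ht_add_two_le_length_of_down hjd
    rw [length_iterate_fill] at hhigh
    omega
  · intro k hk
    by_contra hkt
    have hlow : HasDownstepBelow P (lv P) := ⟨i, hi, hlv.le⟩
    obtain ⟨j, hj, -⟩ := hlow.iterate_fill (t := k) (by omega)
    change fill^[k] P = maxPath P.length at hk
    rw [← length_iterate_fill P k, eq_maxPath_iff] at hk
    exact Bool.noConfusion ((hk j).symm.trans hj)
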